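/- For each q with 0 ≤ q ≤ n−ℓ and each subset J ⊆ {ℓ+1,…,n} with |J| = q, let A_J be the ℂ-span in A of the elements a_{I,J} over all tuples I = (i₁,…,i_q) with 1 ≤ i_p < j_p. Then A^q is the internal direct sum A^q = ⊕_J A_J over the subsets J ⊆ {ℓ+1,…,n} of cardinality q (the submodules A_J are independent and their sum is A^q). -/

import Mathlib

namespace OSDisc

/-- Hyperplane index set: pairs (i,j) with 1 ≤ i < j, ℓ+1 ≤ j ≤ n. -/
def Idx (ℓ n : ℕ) : Type :=
  {p : ℕ × ℕ // 1 ≤ p.1 ∧ p.1 < p.2 ∧ ℓ + 1 ≤ p.2 ∧ p.2 ≤ n}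

/-- The exterior algebra E over ℂ on the vector space with basis e_{i,j}. -/
abbrev E (ℓ n : ℕ) : Type := ExteriorAlgebra ℂ (Idx ℓ n →₀ ℂ)

/-- The generators e_{i,j} of E (junk value 0 for invalid indices). -/
noncomputable def gen (ℓ n : ℕ) (i j : ℕ) : E ℓ n :=
  if h : 1 ≤ i ∧ i < j ∧ ℓ + 1 ≤ j ∧ j ≤ n then
    ExteriorAlgebra.ι ℂ (Finsupp.single (⟨(i, j), h⟩ : Idx ℓ n) (1 : ℂ))
  else 0

/-- Relations generating the Orlik-Solomon ideal. -/
def rel (ℓ n : ℕ) : E ℓ n → E ℓ n → Prop := fun x y =>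
  y = 0 ∧
    ((∃ i j k, 1 ≤ i ∧ i < j ∧ j < k ∧ k ≤ n ∧ ℓ + 1 ≤ j ∧
        x = gen ℓ n i j * gen ℓ n i k - gen ℓ n i j * gen ℓ n j k
            + gen ℓ n i k * gen ℓ n j k) ∨
      (∃ i j k, 1 ≤ i ∧ i < j ∧ j ≤ ℓ ∧ ℓ < k ∧ k ≤ n ∧
        x = gen ℓ n i k * gen ℓ n j k))

/-- The Orlik-Solomon algebra A = E/I of the discriminantal arrangement A_{n,ℓ}. -/
abbrev A (ℓ n : ℕ) : Type := RingQuot (rel ℓ n)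

/-- The quotient map E → A. -/
noncomputable def projA (ℓ n : ℕ) : E ℓ n →ₐ[ℂ] A ℓ n := RingQuot.mkAlgHom ℂ (rel ℓ n)

/-- The generators a_{i,j} of A. -/
noncomputable def a (ℓ n : ℕ) (i j : ℕ) : A ℓ n := projA ℓ n (gen ℓ n i j)

/-- The degree-q component E^q of the exterior algebra. -/
noncomputable def Edeg (ℓ n : ℕ) (q : ℕ) : Submodule ℂ (E ℓ n) :=
  (LinearMap.range (ExteriorAlgebra.ι ℂ : (Idx ℓ n →₀ ℂ) →ₗ[ℂ] E ℓ n)) ^ q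

/-- A^q: the image in A of the degree-q component of E. -/
noncomputable def Adeg (ℓ n : ℕ) (q : ℕ) : Submodule ℂ (A ℓ n) :=
  (Edeg ℓ n q).map (projA ℓ n).toLinearMap

/-- The element a_{I,J}: the product of a_{f j, j} over j ∈ J in increasing order. -/
noncomputable def aIJ (ℓ n : ℕ) (J : Finset ℕ) (f : ℕ → ℕ) : A ℓ n :=
  ((J.sort (· ≤ ·)).map fun j => a ℓ n (f j) j).prod

/-- ω_λ ∈ A¹. -/
noncomputable def omega (ℓ n : ℕ) (lam : ℕ × ℕ → ℂ) : A ℓ n :=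
  ∑ j ∈ Finset.Icc (ℓ + 1) n, ∑ i ∈ Finset.Ico 1 j, lam (i, j) • a ℓ n i j

/-- ω_{k,λ} = Σ_{i=1}^{k−1} λ_{i,k}·a_{i,k}. -/
noncomputable def omegaK (ℓ n : ℕ) (lam : ℕ × ℕ → ℂ) (k : ℕ) : A ℓ n :=
  ∑ i ∈ Finset.Ico 1 k, lam (i, k) • a ℓ n i k



/-- The subspace A_J ⊆ A spanned by the a_{I,J} for fixed J. -/
noncomputable def AJ (ℓ n : ℕ) (J : Finset ℕ) : Submodule ℂ (A ℓ n) :=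
  Submodule.span ℂ
    {x : A ℓ n | ∃ f : ℕ → ℕ, (∀ j ∈ J, 1 ≤ f j ∧ f j < j) ∧ x = aIJ ℓ n J f}

section

open Finset

/-- The ancestor of `k` in the forest with parent function `f`, after all edges whose child is
smaller than `t` have been cut. -/
def root (f : ℕ → ℕ) (t k : ℕ) : ℕ :=
  if t ≤ k ∧ f k < k then root f t (f k) else k
termination_by k

theorem root_of_lt {f : ℕ → ℕ} {t k : ℕ} (h : k < t) : root f t k = k := by
  rw [root, if_neg (by omega)]

theorem root_self {f : ℕ → ℕ} {k : ℕ} (h : f k < k) : root f k k = f k := by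
  rw [root, if_pos ⟨le_rfl, h⟩, root_of_lt h]

theorem root_root {f : ℕ → ℕ} {s t : ℕ} (hst : s ≤ t) (k : ℕ) :
    root f s (root f t k) = root f s k := by
  induction k using Nat.strong_induction_on with
  | _ k ih =>
    by_cases h : t ≤ k ∧ f k < k
    · rw [root.eq_1 f t k, if_pos h, ih _ h.2, root.eq_1 f s k, if_pos ⟨by omega, h.2⟩]
    · rw [root.eq_1 f t k, if_neg h]

/-- The smallest label of an edge on the path joining `i` and `j` in the forest with parent
function `f`, each edge being labelled by its child; it is `0` if there is no such path. -/
def pathMin (ℓ n : ℕ) (f : ℕ → ℕ) (i j : ℕ) : ℕ :=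
  ((Icc (ℓ + 1) n).filter fun t => root f t i = root f t j).sup id

theorem le_pathMin_iff {ℓ n : ℕ} {f : ℕ → ℕ} {i j t : ℕ} (ht : t ∈ Icc (ℓ + 1) n) :
    t ≤ pathMin ℓ n f i j ↔ root f t i = root f t j := by
  constructor
  · intro h
    have h0 : 0 < t := by rw [mem_Icc] at ht; omega
    obtain ⟨s, hs, hts⟩ := (Finset.le_sup_iff (by simpa using h0)).1 h
    rw [mem_filter] at hs
    rw [← root_root (show t ≤ s from hts), hs.2, root_root (show t ≤ s from hts)]
  · intro h
    exact Finset.le_sup (f := id) (mem_filter.2 ⟨ht, h⟩)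

theorem pathMin_eq_zero_or_mem (ℓ n : ℕ) (f : ℕ → ℕ) (i j : ℕ) :
    pathMin ℓ n f i j = 0 ∨ pathMin ℓ n f i j ∈ Icc (ℓ + 1) n := by
  rcases ((Icc (ℓ + 1) n).filter fun t => root f t i = root f t j).eq_empty_or_nonempty with h | h
  · left; simp [pathMin, h]
  · right
    obtain ⟨s, hs, h⟩ := Finset.exists_mem_eq_sup _ h id
    rw [pathMin, h]
    exact (mem_filter.1 hs).1

theorem pathMin_comm (ℓ n : ℕ) (f : ℕ → ℕ) (i j : ℕ) :
    pathMin ℓ n f i j = pathMin ℓ n f j i := by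
  simp only [pathMin, eq_comm]

theorem min_pathMin_le (ℓ n : ℕ) (f : ℕ → ℕ) (i j k : ℕ) :
    min (pathMin ℓ n f i j) (pathMin ℓ n f j k) ≤ pathMin ℓ n f i k := by
  have h : min (pathMin ℓ n f i j) (pathMin ℓ n f j k) = 0 ∨
      min (pathMin ℓ n f i j) (pathMin ℓ n f j k) ∈ Icc (ℓ + 1) n := by
    rcases pathMin_eq_zero_or_mem ℓ n f i j with h | h
    · left; omega
    rcases pathMin_eq_zero_or_mem ℓ n f j k with h' | h'
    · left; omega
    · right; rw [mem_Icc] at *; omega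
  rcases h with h | h
  · omega
  · rw [le_pathMin_iff h, (le_pathMin_iff h).1 (min_le_left _ _),
      (le_pathMin_iff h).1 (min_le_right _ _)]

theorem pathMin_le {ℓ n : ℕ} (f : ℕ → ℕ) {i j : ℕ} (hij : i < j) : pathMin ℓ n f i j ≤ j := by
  rcases pathMin_eq_zero_or_mem ℓ n f i j with h | h
  · omega
  · by_contra! hlt
    have := (le_pathMin_iff h).1 le_rfl
    rw [root_of_lt (hij.trans hlt), root_of_lt hlt] at this
    omega

theorem pathMin_eq_zero {ℓ n : ℕ} (f : ℕ → ℕ) {i j : ℕ} (hij : i < j) (hj : j ≤ ℓ) :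
    pathMin ℓ n f i j = 0 := by
  rcases pathMin_eq_zero_or_mem ℓ n f i j with h | h
  · exact h
  · have := pathMin_le (ℓ := ℓ) (n := n) f hij
    rw [mem_Icc] at h
    omega

theorem pathMin_eq_iff {ℓ n : ℕ} {f : ℕ → ℕ} {i j : ℕ} (hij : i < j) (hf : f j < j)
    (hj : j ∈ Icc (ℓ + 1) n) : pathMin ℓ n f i j = j ↔ i = f j := by
  have h := le_pathMin_iff (f := f) (i := i) (j := j) hj
  rw [root_of_lt hij, root_self hf] at h
  rw [← h]
  exact ⟨fun h => h.ge, fun h => le_antisymm (pathMin_le f hij) h⟩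

/-- The degree-one element of index `m` of the target exterior algebra, with `0` at `m = 0`. -/
noncomputable def dir (m : ℕ) : ℕ →₀ ℂ := if m = 0 then 0 else Finsupp.single m 1

theorem ultrametric_relation {x y z : ℕ} (h₁ : min x z ≤ y) (h₂ : min x y ≤ z)
    (h₃ : min y z ≤ x) :
    ExteriorAlgebra.ι ℂ (dir x) * ExteriorAlgebra.ι ℂ (dir y) -
      ExteriorAlgebra.ι ℂ (dir x) * ExteriorAlgebra.ι ℂ (dir z) +
      ExteriorAlgebra.ι ℂ (dir y) * ExteriorAlgebra.ι ℂ (dir z) = 0 := by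
  have : x = y ∨ x = z ∨ y = z := by omega
  rcases this with rfl | rfl | rfl
  · simp
  · simp
  · simp

/-- The map of exterior algebras sending `e_{i,j}` to `ε (pathMin i j)`. -/
noncomputable def forestMapE (ℓ n : ℕ) (f : ℕ → ℕ) : E ℓ n →ₐ[ℂ] ExteriorAlgebra ℂ (ℕ →₀ ℂ) :=
  ExteriorAlgebra.map
    (Finsupp.linearCombination ℂ fun p : Idx ℓ n => dir (pathMin ℓ n f p.1.1 p.1.2))

theorem forestMapE_gen {ℓ n : ℕ} (f : ℕ → ℕ) {i j : ℕ}
    (h : 1 ≤ i ∧ i < j ∧ ℓ + 1 ≤ j ∧ j ≤ n) :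
    forestMapE ℓ n f (gen ℓ n i j) = ExteriorAlgebra.ι ℂ (dir (pathMin ℓ n f i j)) := by
  rw [gen, dif_pos h, forestMapE, ExteriorAlgebra.map_apply_ι]
  exact congrArg _ ((Finsupp.linearCombination_single ℂ 1 _).trans (one_smul _ _))

theorem forestMapE_rel {ℓ n : ℕ} (f : ℕ → ℕ) ⦃x y : E ℓ n⦄ (h : rel ℓ n x y) :
    forestMapE ℓ n f x = forestMapE ℓ n f y := by
  obtain ⟨rfl, ⟨i, j, k, hi, hij, hjk, hk, hj, rfl⟩ | ⟨i, j, k, hi, hij, hj, hjk, hk, rfl⟩⟩ := h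
  · simp only [map_add, map_sub, map_mul, map_zero]
    rw [forestMapE_gen f (by omega), forestMapE_gen f (by omega), forestMapE_gen f (by omega)]
    apply ultrametric_relation
    · exact min_pathMin_le ℓ n f i j k
    · rw [pathMin_comm ℓ n f i j]
      exact min_pathMin_le ℓ n f j i k
    · rw [pathMin_comm ℓ n f j k]
      exact min_pathMin_le ℓ n f i k j
  · simp only [map_mul, map_zero]
    rw [forestMapE_gen f (by omega), forestMapE_gen f (by omega)]
    have h := min_pathMin_le ℓ n f i k j
    rw [pathMin_eq_zero f hij hj, pathMin_comm ℓ n f k j] at h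
    rcases (by omega : pathMin ℓ n f i k = 0 ∨ pathMin ℓ n f j k = 0) with h | h <;>
      simp [h, dir]

/-- The algebra map `A → Λ(ε_{ℓ+1}, …, ε_n)` given by iterated residues along the forest `f`. -/
noncomputable def forestMap (ℓ n : ℕ) (f : ℕ → ℕ) : A ℓ n →ₐ[ℂ] ExteriorAlgebra ℂ (ℕ →₀ ℂ) :=
  RingQuot.liftAlgHom ℂ ⟨forestMapE ℓ n f, forestMapE_rel f⟩

theorem forestMap_a {ℓ n : ℕ} (f : ℕ → ℕ) {i j : ℕ}
    (h : 1 ≤ i ∧ i < j ∧ ℓ + 1 ≤ j ∧ j ≤ n) :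
    forestMap ℓ n f (a ℓ n i j) = ExteriorAlgebra.ι ℂ (dir (pathMin ℓ n f i j)) := by
  rw [a, projA, forestMap, RingQuot.liftAlgHom_mkAlgHom_apply, forestMapE_gen f h]

theorem forestMap_aIJ {ℓ n q : ℕ} (f g : ℕ → ℕ) {J : Finset ℕ} (hJ : J ⊆ Icc (ℓ + 1) n)
    (hq : J.card = q) (hg : ∀ j ∈ J, 1 ≤ g j ∧ g j < j) :
    forestMap ℓ n f (aIJ ℓ n J g) = ExteriorAlgebra.ιMulti ℂ q fun t =>
      dir (pathMin ℓ n f (g (J.orderEmbOfFin hq t)) (J.orderEmbOfFin hq t)) := by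
  rw [aIJ, map_list_prod, ← listMap_orderEmbOfFin_finRange J hq, ExteriorAlgebra.ιMulti_apply,
    List.ofFn_eq_map]
  simp only [List.map_map]
  congr 1
  refine List.map_congr_left fun t _ => ?_
  have ht := J.orderEmbOfFin_mem hq t
  have := mem_Icc.1 (hJ ht)
  exact forestMap_a f ⟨(hg _ ht).1, (hg _ ht).2, this⟩

/-- The coefficient of `ε_{e 0} ∧ ⋯ ∧ ε_{e (q-1)}` on the target exterior algebra. -/
noncomputable def wedgeCoeff {q : ℕ} (e : Fin q → ℕ) :
    ExteriorAlgebra ℂ (ℕ →₀ ℂ) →ₗ[ℂ] ℂ :=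
  ExteriorAlgebra.liftAlternating <| Pi.single q <|
    Matrix.detRowAlternating.compLinearMap <| LinearMap.pi fun s => Finsupp.lapply (e s)

theorem wedgeCoeff_ιMulti {q : ℕ} (e : Fin q → ℕ) (v : Fin q → ℕ →₀ ℂ) :
    wedgeCoeff e (ExteriorAlgebra.ιMulti ℂ q v) = (Matrix.of fun t s => v t (e s)).det := by
  rw [wedgeCoeff, ExteriorAlgebra.liftAlternating_apply_ιMulti, Pi.single_eq_same]
  rfl

theorem wedgeCoeff_self {q : ℕ} {e : Fin q → ℕ} (he : Function.Injective e)
    (h0 : ∀ t, e t ≠ 0) :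
    wedgeCoeff e (ExteriorAlgebra.ιMulti ℂ q fun t => dir (e t)) = 1 := by
  rw [wedgeCoeff_ιMulti, ← Matrix.det_one (n := Fin q)]
  congr 1
  ext t s
  simp [dir, h0, Matrix.one_apply, Finsupp.single_apply, he.eq_iff]

theorem exists_perm_of_wedgeCoeff_ne_zero {q : ℕ} {e m : Fin q → ℕ}
    (h : wedgeCoeff e (ExteriorAlgebra.ιMulti ℂ q fun t => dir (m t)) ≠ 0) :
    ∃ σ : Equiv.Perm (Fin q), ∀ t, m (σ t) = e t := by
  rw [wedgeCoeff_ιMulti, Matrix.det_apply] at h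
  obtain ⟨σ, -, hσ⟩ := exists_ne_zero_of_sum_ne_zero h
  refine ⟨σ, fun t => ?_⟩
  have hprod := right_ne_zero_of_smul hσ
  have ht := prod_ne_zero_iff.1 hprod t (mem_univ t)
  by_contra hne
  apply ht
  simp only [Matrix.of_apply, dir]
  split_ifs
  · rfl
  · exact Finsupp.single_eq_of_ne (Ne.symm hne)

theorem sum_orderEmbOfFin {q : ℕ} (J : Finset ℕ) (hq : J.card = q) :
    ∑ t, J.orderEmbOfFin hq t = ∑ j ∈ J, j := by
  conv_rhs => rw [← J.map_orderEmbOfFin_univ hq, sum_map]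
  rfl

/-- A family of vectors is linearly independent if it is triangular with respect to a family of
functionals and a weight. -/
theorem linearIndependent_of_triangular {ι K V : Type*} [Field K] [AddCommGroup V] [Module K V]
    (v : ι → V) (L : ι → V →ₗ[K] K) (w : ι → ℕ) (hdiag : ∀ p, L p (v p) ≠ 0)
    (htri : ∀ p p', L p (v p') ≠ 0 → p' = p ∨ w p < w p') : LinearIndependent K v := by
  classical
  rw [linearIndependent_iff']
  intro s c hc
  by_contra! hne
  obtain ⟨p₀, hp₀, hcp₀⟩ := hne
  obtain ⟨p, hp, hmax⟩ := exists_max_image (s.filter fun p => c p ≠ 0) w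
    ⟨p₀, mem_filter.2 ⟨hp₀, hcp₀⟩⟩
  rw [mem_filter] at hp
  have h := congrArg (L p) hc
  rw [map_sum, map_zero, sum_eq_single_of_mem p hp.1] at h
  · rw [map_smul, smul_eq_mul] at h
    exact mul_ne_zero hp.2 (hdiag p) h
  · intro p' hp' hpp'
    rw [map_smul, smul_eq_mul]
    by_contra! h0
    rcases htri p p' (right_ne_zero_of_mul h0) with h1 | h1
    · exact hpp' h1
    · have := hmax p' (mem_filter.2 ⟨hp', left_ne_zero_of_mul h0⟩)
      omega

/-- The pairs `(J, f)` indexing the monomials `a_{I,J}` of degree `q`, with `f` extended by `0`. -/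
def Mon (ℓ n q : ℕ) : Type :=
  {p : Finset ℕ × (ℕ → ℕ) // p.1 ⊆ Icc (ℓ + 1) n ∧ p.1.card = q ∧
    (∀ j ∈ p.1, 1 ≤ p.2 j ∧ p.2 j < j) ∧ ∀ j ∉ p.1, p.2 j = 0}

theorem linearIndependent_aIJ (ℓ n q : ℕ) :
    LinearIndependent ℂ fun p : Mon ℓ n q => aIJ ℓ n p.1.1 p.1.2 := by
  refine linearIndependent_of_triangular _
    (fun p => wedgeCoeff (p.1.1.orderEmbOfFin p.2.2.1) ∘ₗ (forestMap ℓ n p.1.2).toLinearMap)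
    (fun p => ∑ j ∈ p.1.1, j) ?_ ?_
  · rintro ⟨⟨J, f⟩, hJ, hq, hf, hf0⟩
    have hmem := J.orderEmbOfFin_mem hq
    simp only [LinearMap.comp_apply, AlgHom.toLinearMap_apply]
    rw [forestMap_aIJ f f hJ hq hf]
    have : ∀ t, pathMin ℓ n f (f (J.orderEmbOfFin hq t)) (J.orderEmbOfFin hq t) =
        J.orderEmbOfFin hq t := fun t =>
      (pathMin_eq_iff (hf _ (hmem t)).2 (hf _ (hmem t)).2 (hJ (hmem t))).2 rfl
    simp only [this]
    rw [wedgeCoeff_self (J.orderEmbOfFin hq).injective]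
    · exact one_ne_zero
    · intro t
      have := (hf _ (hmem t)).2
      omega
  · rintro ⟨⟨J, f⟩, hJ, hq, hf, hf0⟩ ⟨⟨J', g⟩, hJ', hq', hg, hg0⟩ h
    have hmem := J'.orderEmbOfFin_mem hq'
    simp only [LinearMap.comp_apply, AlgHom.toLinearMap_apply] at h
    rw [forestMap_aIJ f g hJ' hq' hg] at h
    obtain ⟨σ, hσ⟩ := exists_perm_of_wedgeCoeff_ne_zero h
    simp only at hσ ⊢
    rw [or_iff_not_imp_right, not_lt]
    intro hle
    have hlab : ∀ t ∈ univ, pathMin ℓ n f (g (J'.orderEmbOfFin hq' t)) (J'.orderEmbOfFin hq' t) ≤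
        J'.orderEmbOfFin hq' t := fun t _ => pathMin_le f (hg _ (hmem t)).2
    have hsum : ∑ t, pathMin ℓ n f (g (J'.orderEmbOfFin hq' t)) (J'.orderEmbOfFin hq' t) =
        ∑ j ∈ J, j := by
      rw [← sum_orderEmbOfFin J hq, ← Equiv.sum_comp σ]
      exact sum_congr rfl fun t _ => hσ t
    have heq := (sum_eq_sum_iff_of_le hlab).1 (le_antisymm (sum_le_sum hlab)
      (by rw [hsum, sum_orderEmbOfFin]; exact hle))
    have hJJ : J = J' := by
      refine eq_of_subset_of_card_le (fun j hj => ?_) (by rw [hq, hq'])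
      obtain ⟨t, rfl⟩ : j ∈ Set.range (J.orderEmbOfFin hq) := by
        rwa [range_orderEmbOfFin]
      rw [← hσ t, heq _ (mem_univ _)]
      exact hmem _
    subst hJJ
    have hfg : g = f := by
      funext j
      by_cases hj : j ∈ J
      · obtain ⟨t, rfl⟩ : j ∈ Set.range (J.orderEmbOfFin hq) := by
          rwa [range_orderEmbOfFin]
        exact (pathMin_eq_iff (hg _ hj).2 (hf _ hj).2 (hJ hj)).1 (heq t (mem_univ t))
      · exact (hg0 j hj).trans (hf0 j hj).symm
    subst hfg
    rfl

theorem aIJ_congr {ℓ n : ℕ} {J : Finset ℕ} {f g : ℕ → ℕ} (h : ∀ j ∈ J, f j = g j) :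
    aIJ ℓ n J f = aIJ ℓ n J g := by
  rw [aIJ, aIJ]
  congr 1
  exact List.map_congr_left fun j hj => by rw [h j ((mem_sort _).1 hj)]

theorem AJ_eq_span_image {ℓ n q : ℕ} {J : Finset ℕ} (hJ : J ⊆ Icc (ℓ + 1) n)
    (hq : J.card = q) :
    AJ ℓ n J = Submodule.span ℂ
      ((fun p : Mon ℓ n q => aIJ ℓ n p.1.1 p.1.2) '' {p | p.1.1 = J}) := by
  rw [AJ]
  congr 1
  ext x
  constructor
  · rintro ⟨f, hf, rfl⟩
    refine ⟨⟨(J, fun j => if j ∈ J then f j else 0), hJ, hq, ?_, ?_⟩, rfl, ?_⟩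
    · intro j hj
      simpa [show j ∈ J from hj] using hf j hj
    · intro j hj
      simp [show j ∉ J from hj]
    · exact aIJ_congr fun j hj => by simp [hj]
  · rintro ⟨⟨⟨J', f⟩, hJ', hq', hf, hf0⟩, rfl, rfl⟩
    exact ⟨f, hf, rfl⟩

theorem iSupIndep_AJ (ℓ n q : ℕ) :
    iSupIndep (fun J : {J : Finset ℕ // J ⊆ Icc (ℓ + 1) n ∧ J.card = q} => AJ ℓ n J.1) := by
  rw [iSupIndep_def]
  rintro ⟨J, hJ, hq⟩
  refine ((linearIndependent_aIJ ℓ n q).disjoint_span_image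
    (s := {p | p.1.1 = J}) (t := {p | p.1.1 ≠ J}) ?_).mono ?_ ?_
  · exact Set.disjoint_left.2 fun p hp hp' => hp' hp
  · exact (AJ_eq_span_image hJ hq).le
  · refine iSup₂_le ?_
    rintro ⟨J', hJ', hq'⟩ hne
    rw [AJ_eq_span_image hJ' hq']
    refine Submodule.span_mono (Set.image_mono ?_)
    rintro p rfl h
    exact hne (Subtype.ext h)

theorem a_mul_a_swap (ℓ n i j i' j' : ℕ) :
    a ℓ n i j * a ℓ n i' j' = -(a ℓ n i' j' * a ℓ n i j) := by
  rw [a, a, ← map_mul, ← map_mul, ← map_neg]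
  congr 1
  rw [gen, gen]
  split_ifs
  · exact eq_neg_of_add_eq_zero_left (ExteriorAlgebra.ι_add_mul_swap _ _)
  all_goals simp

theorem a_mul_self (ℓ n i j : ℕ) : a ℓ n i j * a ℓ n i j = 0 := by
  rw [a, ← map_mul, gen]
  split_ifs <;> simp

theorem a_three_term {ℓ n i j k : ℕ} (hi : 1 ≤ i) (hij : i < j) (hjk : j < k) (hk : k ≤ n)
    (hj : ℓ + 1 ≤ j) :
    a ℓ n i k * a ℓ n j k = a ℓ n i j * (a ℓ n j k - a ℓ n i k) := by
  have h := RingQuot.mkAlgHom_rel ℂ (s := rel ℓ n)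
    ⟨rfl, Or.inl ⟨i, j, k, hi, hij, hjk, hk, hj, rfl⟩⟩
  simp only [map_add, map_sub, map_mul, map_zero] at h
  have h' : a ℓ n i j * a ℓ n i k - a ℓ n i j * a ℓ n j k + a ℓ n i k * a ℓ n j k = 0 := h
  rw [mul_sub, ← sub_eq_zero, ← h']
  abel

theorem a_mul_a_eq_zero {ℓ n i j k : ℕ} (hi : 1 ≤ i) (hij : i < j) (hj : j ≤ ℓ) (hk : ℓ < k)
    (hkn : k ≤ n) : a ℓ n i k * a ℓ n j k = 0 := by
  have h := RingQuot.mkAlgHom_rel ℂ (s := rel ℓ n)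
    ⟨rfl, Or.inr ⟨i, j, k, hi, hij, hj, hk, hkn, rfl⟩⟩
  simp only [map_mul, map_zero] at h
  exact h

theorem a_mul_a_same {ℓ n i k m : ℕ} (hi : 1 ≤ i) (hk : 1 ≤ k) (him : i < m) (hkm : k < m)
    (hm : ℓ + 1 ≤ m) (hmn : m ≤ n) :
    a ℓ n k m * a ℓ n i m = 0 ∨ ∃ p r, 1 ≤ p ∧ p < r ∧ ℓ + 1 ≤ r ∧ r < m ∧
      a ℓ n k m * a ℓ n i m = a ℓ n p r * (a ℓ n i m - a ℓ n k m) := by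
  rcases lt_trichotomy i k with h | rfl | h
  · by_cases hkl : k ≤ ℓ
    · left
      rw [a_mul_a_swap, a_mul_a_eq_zero hi h hkl (by omega) hmn, neg_zero]
    · right
      refine ⟨i, k, hi, h, by omega, hkm, ?_⟩
      rw [a_mul_a_swap, a_three_term hi h hkm hmn (by omega), ← mul_neg, neg_sub]
  · exact Or.inl (a_mul_self ..)
  · by_cases hil : i ≤ ℓ
    · exact Or.inl (a_mul_a_eq_zero hk h hil (by omega) hmn)
    · exact Or.inr ⟨k, i, hk, h, by omega, him, a_three_term hk h him hmn (by omega)⟩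

theorem aIJ_insert {ℓ n k : ℕ} {J : Finset ℕ} (f : ℕ → ℕ) (h : ∀ j ∈ J, j < k) :
    aIJ ℓ n (insert k J) f = aIJ ℓ n J f * a ℓ n (f k) k := by
  have hk : k ∉ J := fun hk => lt_irrefl _ (h k hk)
  have hsort : (insert k J).sort (· ≤ ·) = J.sort (· ≤ ·) ++ [k] := by
    refine List.Perm.eq_of_pairwise' (r := (· ≤ ·)) (pairwise_sort _ _) ?_ ?_
    · rw [List.pairwise_append]
      refine ⟨pairwise_sort _ _, List.pairwise_singleton _ _, fun x hx y hy => ?_⟩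
      rw [List.mem_singleton.1 hy]
      exact (h x ((mem_sort _).1 hx)).le
    · rw [List.perm_ext_iff_of_nodup (sort_nodup _ _)]
      · intro x
        simp [or_comm]
      · rw [List.nodup_append]
        refine ⟨sort_nodup _ _, List.nodup_singleton _, fun x hx y hy => ?_⟩
        rw [List.mem_singleton.1 hy]
        rintro rfl
        exact hk ((mem_sort _).1 hx)
  rw [aIJ, hsort, List.map_append, List.prod_append, aIJ, List.map_singleton, List.prod_singleton]

/-- The span of the monomials `a_{I,J}` of degree `q` with `J ⊆ {ℓ+1, …, m}`. -/
noncomputable def monSpan (ℓ n m q : ℕ) : Submodule ℂ (A ℓ n) :=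
  Submodule.span ℂ {x | ∃ (J : Finset ℕ) (f : ℕ → ℕ), J ⊆ Icc (ℓ + 1) m ∧ J.card = q ∧
    (∀ j ∈ J, 1 ≤ f j ∧ f j < j) ∧ x = aIJ ℓ n J f}

theorem monSpan_mono {ℓ n m m' q : ℕ} (h : m ≤ m') : monSpan ℓ n m q ≤ monSpan ℓ n m' q := by
  refine Submodule.span_mono ?_
  rintro x ⟨J, f, hJ, hq, hf, rfl⟩
  exact ⟨J, f, hJ.trans (Icc_subset_Icc_right h), hq, hf, rfl⟩

theorem mul_a_top_mem_monSpan {ℓ n m q i : ℕ} (hi : 1 ≤ i) (him : i < m + 1)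
    (hm : ℓ + 1 ≤ m + 1) {x : A ℓ n} (hx : x ∈ monSpan ℓ n m q) :
    x * a ℓ n i (m + 1) ∈ monSpan ℓ n (m + 1) (q + 1) := by
  induction hx using Submodule.span_induction with
  | mem x hx =>
    obtain ⟨J, f, hJ, hq, hf, rfl⟩ := hx
    have hlt : ∀ j ∈ J, j < m + 1 := fun j hj => by
      have := mem_Icc.1 (hJ hj)
      omega
    have hnot : m + 1 ∉ J := fun h => lt_irrefl _ (hlt _ h)
    refine Submodule.subset_span
      ⟨insert (m + 1) J, Function.update f (m + 1) i, ?_, ?_, ?_, ?_⟩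
    · exact insert_subset (mem_Icc.2 ⟨hm, le_rfl⟩)
        (hJ.trans (Icc_subset_Icc_right (Nat.le_succ m)))
    · rw [card_insert_of_notMem hnot, hq]
    · intro j hj
      rcases mem_insert.1 hj with rfl | hj
      · rw [Function.update_self]
        exact ⟨hi, him⟩
      · rw [Function.update_of_ne (hlt j hj).ne]
        exact hf j hj
    · rw [aIJ_insert _ hlt, Function.update_self]
      congr 1
      exact aIJ_congr fun j hj => (Function.update_of_ne (hlt j hj).ne _ _).symm
  | zero => rw [zero_mul]; exact zero_mem _
  | add x y _ _ hx hy => rw [add_mul]; exact add_mem hx hy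
  | smul c x _ hx => rw [smul_mul_assoc]; exact Submodule.smul_mem _ c hx

theorem mul_a_mem_monSpan {ℓ n m : ℕ} (hmn : m ≤ n) {q i j : ℕ} (hi : 1 ≤ i) (hij : i < j)
    (hj : ℓ + 1 ≤ j) (hjm : j ≤ m) {x : A ℓ n} (hx : x ∈ monSpan ℓ n m q) :
    x * a ℓ n i j ∈ monSpan ℓ n m (q + 1) := by
  induction m generalizing q i j x with
  | zero => omega
  | succ m ih =>
    specialize @ih (by omega)
    induction hx using Submodule.span_induction with
    | zero => rw [zero_mul]; exact zero_mem _
    | add x y _ _ hx hy => rw [add_mul]; exact add_mem hx hy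
    | smul c x _ hx => rw [smul_mul_assoc]; exact Submodule.smul_mem _ c hx
    | mem x hx =>
      obtain ⟨J, f, hJ, hq, hf, rfl⟩ := hx
      have hsub : J.erase (m + 1) ⊆ Icc (ℓ + 1) m := fun r hr => by
        have h₁ := mem_Icc.1 (hJ (mem_of_mem_erase hr))
        have h₂ := ne_of_mem_erase hr
        exact mem_Icc.2 (by omega)
      by_cases htop : m + 1 ∈ J
      · obtain ⟨hk, hkm⟩ := hf _ htop
        obtain ⟨q, rfl⟩ : ∃ q', q = q' + 1 := Nat.exists_eq_add_one.2
          (hq ▸ card_pos.2 ⟨_, htop⟩)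
        have hy : aIJ ℓ n (J.erase (m + 1)) f ∈ monSpan ℓ n m q :=
          Submodule.subset_span ⟨_, f, hsub, by rw [card_erase_of_mem htop, hq]; rfl,
            fun r hr => hf r (mem_of_mem_erase hr), rfl⟩
        rw [← insert_erase htop, aIJ_insert f fun r hr => by
          have := mem_Icc.1 (hsub hr)
          omega]
        generalize aIJ ℓ n (J.erase (m + 1)) f = y at hy
        rw [mul_assoc]
        rcases hjm.lt_or_eq with hlt | rfl
        · rw [a_mul_a_swap, mul_neg, ← mul_assoc]
          exact neg_mem (mul_a_top_mem_monSpan hk hkm (by omega) (ih hi hij hj (by omega) hy))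
        · rcases a_mul_a_same hi hk hij hkm hj hmn with h | ⟨p, r, hp, hpr, hr, hrm, h⟩
          · rw [h, mul_zero]
            exact zero_mem _
          · have hz := ih hp hpr hr (by omega) hy
            rw [h, ← mul_assoc, mul_sub]
            exact sub_mem (mul_a_top_mem_monSpan hi hij hj hz)
              (mul_a_top_mem_monSpan hk hkm hj hz)
      · rw [erase_eq_of_notMem htop] at hsub
        have hx : aIJ ℓ n J f ∈ monSpan ℓ n m q :=
          Submodule.subset_span ⟨J, f, hsub, hq, hf, rfl⟩
        rcases hjm.lt_or_eq with hlt | rfl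
        · exact monSpan_mono (Nat.le_succ m) (ih hi hij hj (by omega) hx)
        · exact mul_a_top_mem_monSpan hi hij hj hx

theorem range_ι_le_span_gen (ℓ n : ℕ) :
    LinearMap.range (ExteriorAlgebra.ι ℂ : (Idx ℓ n →₀ ℂ) →ₗ[ℂ] E ℓ n) ≤
      Submodule.span ℂ (Set.range fun p : Idx ℓ n => gen ℓ n p.1.1 p.1.2) := by
  rintro _ ⟨v, rfl⟩
  induction v using Finsupp.induction_linear with
  | zero => rw [map_zero]; exact zero_mem _
  | add v w hv hw => rw [map_add]; exact add_mem hv hw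
  | single p c =>
    rw [← mul_one c, ← smul_eq_mul, ← Finsupp.smul_single, map_smul]
    refine Submodule.smul_mem _ c (Submodule.subset_span ⟨p, ?_⟩)
    exact dif_pos p.2

theorem Adeg_le_monSpan (ℓ n q : ℕ) : Adeg ℓ n q ≤ monSpan ℓ n n q := by
  induction q with
  | zero =>
    rw [Adeg, Edeg, pow_zero, Submodule.one_eq_span, Submodule.map_span, Set.image_singleton,
      Submodule.span_singleton_le_iff_mem]
    refine Submodule.subset_span ⟨∅, id, empty_subset _, card_empty, by simp, ?_⟩
    simp [aIJ]
  | succ q ih =>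
    rw [Adeg, Submodule.map_le_iff_le_comap, Edeg, pow_succ, Submodule.mul_le]
    intro x hx y hy
    have hx' : projA ℓ n x ∈ monSpan ℓ n n q := ih (Submodule.mem_map_of_mem hx)
    have hy' := range_ι_le_span_gen ℓ n hy
    rw [Submodule.mem_comap, AlgHom.toLinearMap_apply, map_mul]
    clear hy
    induction hy' using Submodule.span_induction with
    | zero => rw [map_zero, mul_zero]; exact zero_mem _
    | add y z _ _ hy hz => rw [map_add, mul_add]; exact add_mem hy hz
    | smul c y _ hy => rw [map_smul, mul_smul_comm]; exact Submodule.smul_mem _ c hy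
    | mem y hy =>
      obtain ⟨p, rfl⟩ := hy
      obtain ⟨h₁, h₂, h₃, h₄⟩ := p.2
      exact mul_a_mem_monSpan le_rfl h₁ h₂ h₃ h₄ hx'

theorem gen_mem_range_ι (ℓ n i j : ℕ) :
    gen ℓ n i j ∈ LinearMap.range (ExteriorAlgebra.ι ℂ : (Idx ℓ n →₀ ℂ) →ₗ[ℂ] E ℓ n) := by
  rw [gen]
  split_ifs
  · exact LinearMap.mem_range_self _ _
  · exact zero_mem _

theorem aIJ_mem_Adeg (ℓ n : ℕ) (J : Finset ℕ) (f : ℕ → ℕ) : aIJ ℓ n J f ∈ Adeg ℓ n J.card := by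
  rw [← length_sort (s := J) (· ≤ ·), aIJ]
  generalize J.sort (· ≤ ·) = L
  refine ⟨(L.map fun j => gen ℓ n (f j) j).prod, ?_, ?_⟩
  · induction L with
    | nil => exact Submodule.one_le.1 (by simp [Edeg])
    | cons j L ih =>
      rw [List.map_cons, List.prod_cons, List.length_cons, Edeg, pow_succ']
      exact Submodule.mul_mem_mul (gen_mem_range_ι ..) ih
  · rw [AlgHom.toLinearMap_apply, map_list_prod, List.map_map]
    rfl

theorem iSup_AJ (ℓ n q : ℕ) :
    (⨆ J : {J : Finset ℕ // J ⊆ Icc (ℓ + 1) n ∧ J.card = q}, AJ ℓ n J.1) = Adeg ℓ n q := by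
  apply le_antisymm
  · refine iSup_le ?_
    rintro ⟨J, -, rfl⟩
    rw [AJ, Submodule.span_le]
    rintro x ⟨f, -, rfl⟩
    exact aIJ_mem_Adeg ℓ n J f
  · refine (Adeg_le_monSpan ℓ n q).trans (Submodule.span_le.2 ?_)
    rintro x ⟨J, f, hJ, hq, hf, rfl⟩
    exact Submodule.mem_iSup_of_mem (p := fun J :
      {J : Finset ℕ // J ⊆ Icc (ℓ + 1) n ∧ J.card = q} => AJ ℓ n J.1) ⟨J, hJ, hq⟩
      (Submodule.subset_span ⟨f, hf, rfl⟩)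

end

/-- A^q is the internal direct sum of the subspaces A_J over the subsets
    J ⊆ {ℓ+1,…,n} of cardinality q. -/
theorem statement1 (ℓ n : ℕ) (hℓ : 1 ≤ ℓ) (hn : ℓ < n) (q : ℕ) (hq : q ≤ n - ℓ) :
    iSupIndep (fun J : {J : Finset ℕ // J ⊆ Finset.Icc (ℓ + 1) n ∧ J.card = q} =>
      AJ ℓ n J.1) ∧
    (⨆ J : {J : Finset ℕ // J ⊆ Finset.Icc (ℓ + 1) n ∧ J.card = q}, AJ ℓ n J.1)
      = Adeg ℓ n q := by
  exact ⟨iSupIndep_AJ ℓ n q, iSup_AJ ℓ n q⟩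

end OSDisc
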